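/- Let Λ = U³ ⊕ E8² ⊕ ⟨−2⟩ and let ι ∈ O(Λ) be an involution whose invariant sublattice Λ^ι is isometric to U. Then Λ decomposes as the internal orthogonal direct sum Λ = Λ^ι ⊕ (Λ^ι)^⊥, and the orthogonal complement (Λ^ι)^⊥ is isometric to U² ⊕ E8² ⊕ ⟨−2⟩. -/

import Mathlib

open Matrix

/-- The Gram pairing `(x, y) ↦ xᵀ G y` of an integer matrix `G`, as a bilinear map. -/
def gramBilin {n : ℕ} (G : Matrix (Fin n) (Fin n) ℤ) :
    (Fin n → ℤ) →ₗ[ℤ] (Fin n → ℤ) →ₗ[ℤ] ℤ :=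
  Matrix.toLinearMap₂' ℤ G

/-- The hyperbolic plane `U`, with Gram matrix `[[0,1],[1,0]]`. -/
def UGram : Matrix (Fin 2) (Fin 2) ℤ := !![0, 1; 1, 0]

/-- `U(2)`, with Gram matrix `[[0,2],[2,0]]`. -/
def U2Gram : Matrix (Fin 2) (Fin 2) ℤ := !![0, 2; 2, 0]

/-- `⟨2⟩ ⊕ ⟨-2⟩`. -/
def diag2Gram : Matrix (Fin 2) (Fin 2) ℤ := !![2, 0; 0, -2]

/-- The (negative definite even unimodular) `E8` lattice: the negative of the E₈ Cartan matrix. -/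
def E8Gram : Matrix (Fin 8) (Fin 8) ℤ := -CartanMatrix.E₈

/-- The rank-one lattice `⟨k⟩`. -/
def rankOneGram (k : ℤ) : Matrix (Fin 1) (Fin 1) ℤ := !![k]

/-- Orthogonal direct sum of two bilinear forms, on the product module. -/
def prodBilin {M N : Type*} [AddCommGroup M] [AddCommGroup N] [Module ℤ M] [Module ℤ N]
    (BM : M →ₗ[ℤ] M →ₗ[ℤ] ℤ) (BN : N →ₗ[ℤ] N →ₗ[ℤ] ℤ) :
    (M × N) →ₗ[ℤ] (M × N) →ₗ[ℤ] ℤ :=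
  LinearMap.mk₂ ℤ (fun x y => BM x.1 y.1 + BN x.2 y.2)
    (by intro m₁ m₂ n; simp [map_add]; ring)
    (by intro c m n; simp [_root_.map_smul, smul_eq_mul]; ring)
    (by intro m n₁ n₂; simp [map_add]; ring)
    (by intro c m n; simp [_root_.map_smul, smul_eq_mul]; ring)

/-- The underlying module of `Λ = U³ ⊕ E8² ⊕ ⟨-2⟩`. -/
abbrev LambdaM : Type :=
  (Fin 2 → ℤ) × (Fin 2 → ℤ) × (Fin 2 → ℤ) × (Fin 8 → ℤ) × (Fin 8 → ℤ) × (Fin 1 → ℤ)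

/-- The bilinear form of the Beauville–Bogomolov lattice `Λ = U³ ⊕ E8² ⊕ ⟨-2⟩`. -/
def LambdaB : LambdaM →ₗ[ℤ] LambdaM →ₗ[ℤ] ℤ :=
  prodBilin (gramBilin UGram) <| prodBilin (gramBilin UGram) <| prodBilin (gramBilin UGram) <|
    prodBilin (gramBilin E8Gram) <| prodBilin (gramBilin E8Gram) (gramBilin (rankOneGram (-2)))

/-- Membership in `O(Λ)`: a linear automorphism preserving the form. -/
def IsIsometry (f : LambdaM ≃ₗ[ℤ] LambdaM) : Prop :=
  ∀ x y, LambdaB (f x) (f y) = LambdaB x y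

/-- The invariant sublattice `Λ^ι = {x | ι x = x}`. -/
def invLattice (f : LambdaM ≃ₗ[ℤ] LambdaM) : Submodule ℤ LambdaM :=
  LinearMap.eqLocus (f : LambdaM →ₗ[ℤ] LambdaM) (LinearMap.id)

/-- A submodule of `Λ`, with the restricted form, is isometric to the lattice `(N, BN)`. -/
def IsometricTo {N : Type*} [AddCommGroup N] [Module ℤ N]
    (K : Submodule ℤ LambdaM) (BN : N →ₗ[ℤ] N →ₗ[ℤ] ℤ) : Prop :=
  ∃ e : K ≃ₗ[ℤ] N, ∀ x y : K, BN (e x) (e y) = LambdaB (x : LambdaM) (y : LambdaM)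

/-- `div_Λ(v) = d`: the ideal of values `B(v, ·)` is generated by the positive integer `d`. -/
def HasDivisibility (v : LambdaM) (d : ℤ) : Prop :=
  0 < d ∧ (∀ x, d ∣ LambdaB v x) ∧ ∃ x, LambdaB v x = d

/-- Conjugacy in `O(Λ)`: `ι' = γ ∘ ι ∘ γ⁻¹` for some isometry `γ`. -/
def ConjInO (ι ι' : LambdaM ≃ₗ[ℤ] LambdaM) : Prop :=
  ∃ γ : LambdaM ≃ₗ[ℤ] LambdaM, IsIsometry γ ∧ ∀ x, ι' x = γ (ι (γ.symm x))

/-- A sublattice has signature (1,1): rank two, containing both an element of positive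
square and an element of negative square. -/
def SigOneOne (K : Submodule ℤ LambdaM) : Prop :=
  Module.finrank ℤ K = 2 ∧ (∃ x ∈ K, 0 < LambdaB x x) ∧ (∃ x ∈ K, LambdaB x x < 0)

/-- The orthogonal complement of a submodule of `Λ`. -/
def perpOf (K : Submodule ℤ LambdaM) : Submodule ℤ LambdaM where
  carrier := {x | ∀ s ∈ K, LambdaB x s = 0}
  add_mem' := by
    intro a b ha hb s hs
    simp [map_add, LinearMap.add_apply, ha s hs, hb s hs]
  zero_mem' := by
    intro s hs
    simp
  smul_mem' := by
    intro c a ha s hs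
    simp only [_root_.map_smul, LinearMap.smul_apply, ha s hs, smul_zero]

/-- The bilinear form of the lattice `U² ⊕ E8² ⊕ ⟨−2⟩`. -/
def TargetB14 :
    ((Fin 2 → ℤ) × (Fin 2 → ℤ) × (Fin 8 → ℤ) × (Fin 8 → ℤ) × (Fin 1 → ℤ)) →ₗ[ℤ]
      ((Fin 2 → ℤ) × (Fin 2 → ℤ) × (Fin 8 → ℤ) × (Fin 8 → ℤ) × (Fin 1 → ℤ)) →ₗ[ℤ] ℤ :=
  prodBilin (gramBilin UGram) <| prodBilin (gramBilin UGram) <|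
    prodBilin (gramBilin E8Gram) <| prodBilin (gramBilin E8Gram) (gramBilin (rankOneGram (-2)))

section Transvections

variable {L : Type*} [AddCommGroup L] (B : L →ₗ[ℤ] L →ₗ[ℤ] ℤ)

/-- The linear map underlying the Eichler transvection attached to an isotropic vector `e` and a
vector `m` orthogonal to `e` with `B m m = 2 * k`. -/
def eichlerMap (e m : L) (k : ℤ) : L →ₗ[ℤ] L :=
  LinearMap.id + (B e).smulRight m - (B m).smulRight e - (k • B e).smulRight e

theorem eichlerMap_apply (e m : L) (k : ℤ) (x : L) :
    eichlerMap B e m k x = x + B e x • m - B m x • e - (k * B e x) • e := by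
  simp [eichlerMap]

variable {B}

theorem eichlerMap_neg_eichlerMap {e m : L} {k : ℤ} (hs : ∀ x y, B x y = B y x)
    (he : B e e = 0) (hem : B e m = 0) (hm : B m m = 2 * k) (x : L) :
    eichlerMap B e (-m) k (eichlerMap B e m k x) = x := by
  have hme : B m e = 0 := by rw [hs, hem]
  simp only [eichlerMap_apply, map_add, map_sub, map_neg, map_smul, LinearMap.neg_apply,
    he, hem, hme, hm]
  module

/-- The Eichler transvection, as a linear automorphism. -/
def eichlerEquiv {e m : L} {k : ℤ} (hs : ∀ x y, B x y = B y x)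
    (he : B e e = 0) (hem : B e m = 0) (hm : B m m = 2 * k) : L ≃ₗ[ℤ] L :=
  LinearEquiv.ofLinearMap (eichlerMap B e m k) (eichlerMap B e (-m) k)
    (by
      ext x
      simpa using eichlerMap_neg_eichlerMap (m := -m) (k := k) hs he (by simp [hem])
        (by simp [hm]) x)
    (by
      ext x
      simpa using eichlerMap_neg_eichlerMap hs he hem hm x)

theorem eichlerMap_isometry {e m : L} {k : ℤ} (hs : ∀ x y, B x y = B y x)
    (he : B e e = 0) (hem : B e m = 0) (hm : B m m = 2 * k) (x y : L) :
    B (eichlerMap B e m k x) (eichlerMap B e m k y) = B x y := by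
  have hme : B m e = 0 := by rw [hs, hem]
  simp only [eichlerMap_apply, map_add, map_sub, map_smul, LinearMap.add_apply,
    LinearMap.sub_apply, LinearMap.smul_apply, smul_eq_mul, he, hem, hme, hm, hs x e, hs x m]
  ring

variable (B) in
/-- Two vectors lie in the same orbit of the isometry group of `B`. -/
def SameOrbit (v w : L) : Prop :=
  ∃ φ : L ≃ₗ[ℤ] L, (∀ x y, B (φ x) (φ y) = B x y) ∧ φ v = w

theorem SameOrbit.refl (v : L) : SameOrbit B v v :=
  ⟨LinearEquiv.refl ℤ L, fun _ _ => rfl, rfl⟩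

theorem SameOrbit.trans {u v w : L} (h : SameOrbit B u v) (h' : SameOrbit B v w) :
    SameOrbit B u w := by
  obtain ⟨φ, hφ, rfl⟩ := h
  obtain ⟨ψ, hψ, rfl⟩ := h'
  exact ⟨φ.trans ψ, fun x y => by simp [hφ, hψ], rfl⟩

theorem SameOrbit.neg {v w : L} (h : SameOrbit B v w) : SameOrbit B v (-w) :=
  h.trans ⟨LinearEquiv.neg ℤ, fun x y => by simp, by simp⟩

theorem sameOrbit_eichlerMap {e m : L} {k : ℤ} (hs : ∀ x y, B x y = B y x)
    (he : B e e = 0) (hem : B e m = 0) (hm : B m m = 2 * k) (v : L) :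
    SameOrbit B v (eichlerMap B e m k v) :=
  ⟨eichlerEquiv hs he hem hm, eichlerMap_isometry hs he hem hm, rfl⟩

/-- Two isotropic vectors pairing to `1` with the isotropic vector `f` are exchanged by an isometry
fixing `f`. -/
theorem exists_isometry_of_pairing_eq_one (hs : ∀ x y, B x y = B y x) {e f v : L} (he : B e e = 0) (hf : B f f = 0) (hv : B v v = 0)
    (hfe : B f e = 1) (hfv : B f v = 1) :
    ∃ φ : L ≃ₗ[ℤ] L, (∀ x y, B (φ x) (φ y) = B x y) ∧ φ v = e ∧ φ f = f := by
  have hef : B e f = 1 := by rw [hs, hfe]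
  have hvf : B v f = 1 := by rw [hs, hfv]
  have hve : B v e = B e v := hs v e
  set m : L := e - v + B e v • f with hm
  have hmm : B m m = 2 * -B e v := by
    simp only [hm, map_add, map_sub, map_smul, LinearMap.add_apply, LinearMap.sub_apply,
      LinearMap.smul_apply, smul_eq_mul, he, hf, hv, hfe, hfv, hef, hvf, hve]
    ring
  have hfm : B f m = 0 := by simp [hm, hf, hfe, hfv]
  have hmf : B m f = 0 := by rw [hs, hfm]
  have hmv : B m v = 2 * B e v := by
    simp only [hm, map_add, map_sub, map_smul, LinearMap.add_apply, LinearMap.sub_apply,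
      LinearMap.smul_apply, smul_eq_mul, hv, hfv]
    ring
  refine ⟨eichlerEquiv hs hf hfm hmm, eichlerMap_isometry hs hf hfm hmm, ?_, ?_⟩
  · change eichlerMap B f m _ v = e
    rw [eichlerMap_apply, hfv, hmv, hm]
    module
  · change eichlerMap B f m _ f = f
    simp [eichlerMap_apply, hf, hmf]

/-- If no vector in the orbit of `v` pairs with `f` to a positive integer below `g`, then `g`
divides the pairing of `v` with any isotropic `z` belonging to a hyperbolic plane orthogonal
to `e, f`. -/
theorem dvd_pairing_of_minimal (hs : ∀ x y, B x y = B y x) {e f z z' v w : L} {g : ℤ}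
    (he : B e e = 0) (hf : B f f = 0) (hfe : B f e = 1) (hz : B z z = 0) (hz' : B z' z' = 0)
    (hzz' : B z z' = 1) (hez : B e z = 0) (hfz : B f z = 0) (hfz' : B f z' = 0)
    (hg : 0 < g) (hmin : ∀ u, SameOrbit B v u → 0 < B f u → g ≤ B f u)
    (hvw : SameOrbit B v w) (hw : B f w = g) : g ∣ B z w := by
  have hze : B z e = 0 := by rw [hs, hez]
  have hzf : B z f = 0 := by rw [hs, hfz]
  set t : ℤ := -(B z w / g) with ht
  set w₁ := eichlerMap B f (t • z') 0 w with hw₁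
  have hvw₁ : SameOrbit B v w₁ :=
    hvw.trans (sameOrbit_eichlerMap hs hf (by simp [hfz']) (by simp [hz']) w)
  have hfw₁ : B f w₁ = g := by simp [hw₁, eichlerMap_apply, hf, hfz', hw]
  have hzw₁ : B z w₁ = B z w % g := by
    simp only [hw₁, eichlerMap_apply, map_add, map_sub, map_smul, smul_eq_mul, hzz', hzf, hw, ht]
    rw [Int.emod_def]
    ring
  have hvw₂ := hvw₁.trans (sameOrbit_eichlerMap (e := z) (m := -e) (k := 0) hs hz
    (by simp [hze]) (by simp [he]) w₁)
  have hfw₂ : B f (eichlerMap B z (-e) 0 w₁) = g - B z w % g := by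
    simp only [eichlerMap_apply, map_add, map_sub, map_smul, map_neg, LinearMap.neg_apply,
      smul_eq_mul, hfe, hfz, hfw₁, hzw₁]
    ring
  have h0 := Int.emod_nonneg (B z w) hg.ne'
  have h1 := Int.emod_lt_of_pos (B z w) hg
  have h2 := hmin _ hvw₂ (by rw [hfw₂]; linarith)
  rw [hfw₂] at h2
  exact Int.dvd_of_emod_eq_zero (by linarith)

/-- In an even lattice containing two orthogonal hyperbolic planes, a vector of divisibility one
can be moved by an isometry to pair to `1` with the isotropic vector `f₁`. -/
theorem exists_sameOrbit_pairing_eq_one (hs : ∀ x y, B x y = B y x)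
    (heven : ∀ x, Even (B x x)) {e₁ f₁ e₂ f₂ v v' : L}
    (he₁ : B e₁ e₁ = 0) (hf₁ : B f₁ f₁ = 0) (h₁ : B f₁ e₁ = 1)
    (he₂ : B e₂ e₂ = 0) (hf₂ : B f₂ f₂ = 0) (h₂ : B f₂ e₂ = 1)
    (hee : B e₁ e₂ = 0) (hef : B e₁ f₂ = 0) (hfe : B f₁ e₂ = 0) (hff : B f₁ f₂ = 0)
    (hv : B v v' = 1) : ∃ w, SameOrbit B v w ∧ B f₁ w = 1 := by
  have h₁' : B e₁ f₁ = 1 := by rw [hs, h₁]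
  have h₂' : B e₂ f₂ = 1 := by rw [hs, h₂]
  have hee' : B e₂ e₁ = 0 := by rw [hs, hee]
  have hef' : B f₂ e₁ = 0 := by rw [hs, hef]
  have hfe' : B e₂ f₁ = 0 := by rw [hs, hfe]
  have hff' : B f₂ f₁ = 0 := by rw [hs, hff]
  suffices h : ∃ g : ℤ, 0 ≤ g ∧ (∃ w, SameOrbit B v w ∧ B f₁ w = g) ∧
      ∀ w, SameOrbit B v w → B f₁ w = g → g ∣ B e₂ w ∧ g ∣ B f₂ w by
    obtain ⟨g, hg, ⟨w₀, hvw₀, hw₀⟩, hdvd⟩ := h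
    obtain ⟨w, hvw, hw, hf₂w⟩ : ∃ w, SameOrbit B v w ∧ B f₁ w = g ∧ B f₂ w = 0 := by
      obtain ⟨t, ht⟩ := (hdvd w₀ hvw₀ hw₀).2
      refine ⟨_, hvw₀.trans (sameOrbit_eichlerMap (e := f₁) (m := -t • e₂) (k := 0) hs hf₁
        (by simp [hfe]) (by simp [he₂]) w₀), ?_, ?_⟩
      · simp [eichlerMap_apply, hf₁, hfe, hw₀]
      · simp only [eichlerMap_apply, map_add, map_sub, map_smul, smul_eq_mul, h₂, hff', hw₀, ht]
        ring
    have de₂ : g ∣ B e₂ w := (hdvd w hvw hw).1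
    have de₁ : g ∣ B e₁ w := by
      have h := (hdvd _ (hvw.trans (sameOrbit_eichlerMap (e := e₁) (m := f₂) (k := 0) hs he₁
        hef (by simp [hf₂]) w)) (by simp [eichlerMap_apply, hff, hw, hf₂w])).1
      simp only [eichlerMap_apply, map_add, map_sub, map_smul, smul_eq_mul, h₂', hee', hf₂w,
        mul_one, mul_zero, zero_mul, sub_zero] at h
      exact (dvd_add_right de₂).1 h
    have dm : ∀ m, B m e₂ = 0 → B m f₂ = 0 → B m f₁ = 0 → g ∣ B m w := by
      intro m hme₂ hmf₂ hmf₁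
      obtain ⟨k, hk⟩ := heven m
      have h := (hdvd _ (hvw.trans (sameOrbit_eichlerMap (e := f₂) (m := m) (k := k) hs hf₂
        (by rw [hs, hmf₂]) (by rw [hk]; ring) w))
        (by simp [eichlerMap_apply, hff, hf₂w, hw])).1
      simp only [eichlerMap_apply, map_add, map_sub, map_smul, smul_eq_mul, h₂', hf₂w,
        mul_one, mul_zero, zero_mul, sub_zero, add_zero] at h
      exact (dvd_sub_right de₂).1 h
    have hall : ∀ x, g ∣ B x w := by
      intro x
      have hx := dm (x - B x f₁ • e₁ - B x f₂ • e₂ - B x e₂ • f₂)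
        (by simp [*]) (by simp [*]) (by simp [*])
      have hsum : B x w = B (x - B x f₁ • e₁ - B x f₂ • e₂ - B x e₂ • f₂) w
          + B x f₁ * B e₁ w + B x f₂ * B e₂ w + B x e₂ * B f₂ w := by
        simp only [map_sub, map_smul, LinearMap.sub_apply, LinearMap.smul_apply, smul_eq_mul]
        ring
      rw [hsum, hf₂w, mul_zero, add_zero]
      exact (hx.add (de₁.mul_left _)).add (de₂.mul_left _)
    refine ⟨w, hvw, hw.trans ?_⟩
    obtain ⟨φ, hφ, rfl⟩ := hvw
    have hone := hall (φ v')
    rw [hφ, hs, hv] at hone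
    exact Int.eq_one_of_dvd_one hg hone
  by_cases hne : ∃ n : ℕ, 0 < n ∧ ∃ w, SameOrbit B v w ∧ B f₁ w = n
  · classical
    obtain ⟨hn, hex⟩ := Nat.find_spec hne
    have hmin : ∀ u, SameOrbit B v u → 0 < B f₁ u → ((Nat.find hne : ℕ) : ℤ) ≤ B f₁ u := by
      intro u hu hpos
      have := Nat.find_min' hne (m := (B f₁ u).toNat) ⟨by omega, u, hu, by omega⟩
      omega
    refine ⟨Nat.find hne, by omega, hex, fun w hvw hw => ⟨?_, ?_⟩⟩
    · exact dvd_pairing_of_minimal hs he₁ hf₁ h₁ he₂ hf₂ h₂' hee hfe hff (by omega) hmin hvw hw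
    · exact dvd_pairing_of_minimal hs he₁ hf₁ h₁ hf₂ he₂ h₂ hef hff hfe (by omega) hmin hvw hw
  · have hzero : ∀ w, SameOrbit B v w → B f₁ w = 0 := by
      intro w hvw
      by_contra h0
      refine hne ⟨(B f₁ w).natAbs, by omega, ?_⟩
      rcases le_total 0 (B f₁ w) with h | h
      · exact ⟨w, hvw, by omega⟩
      · exact ⟨-w, hvw.neg, by rw [map_neg]; omega⟩
    have hz : ∀ z w, B z z = 0 → B z e₁ = 0 → B f₁ z = 0 → SameOrbit B v w → B z w = 0 := by
      intro z w hzz hze hfz hvw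
      have h := hzero _ (hvw.trans (sameOrbit_eichlerMap (e := z) (m := e₁) (k := 0) hs hzz
        hze (by simp [he₁]) w))
      simpa [eichlerMap_apply, h₁, hfz, hzero w hvw] using h
    exact ⟨0, le_rfl, ⟨v, .refl v, hzero v (.refl v)⟩, fun w hvw _ =>
      ⟨by rw [hz e₂ w he₂ hee' hfe hvw], by rw [hz f₂ w hf₂ hef' hff hvw]⟩⟩

/-- In an even lattice containing two orthogonal hyperbolic planes, the isometry group acts
transitively on hyperbolic pairs. -/
theorem exists_isometry_hyperbolic_pair (hs : ∀ x y, B x y = B y x)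
    (heven : ∀ x, Even (B x x)) {e₁ f₁ e₂ f₂ v v' : L}
    (he₁ : B e₁ e₁ = 0) (hf₁ : B f₁ f₁ = 0) (h₁ : B f₁ e₁ = 1)
    (he₂ : B e₂ e₂ = 0) (hf₂ : B f₂ f₂ = 0) (h₂ : B f₂ e₂ = 1)
    (hee : B e₁ e₂ = 0) (hef : B e₁ f₂ = 0) (hfe : B f₁ e₂ = 0) (hff : B f₁ f₂ = 0)
    (hvv : B v v = 0) (hvv' : B v' v' = 0) (hv : B v v' = 1) :
    ∃ φ : L ≃ₗ[ℤ] L, (∀ x y, B (φ x) (φ y) = B x y) ∧ φ v = e₁ ∧ φ v' = f₁ := by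
  obtain ⟨_, ⟨φ, hφ, rfl⟩, hw⟩ := exists_sameOrbit_pairing_eq_one hs heven he₁ hf₁ h₁ he₂ hf₂ h₂
    hee hef hfe hff hv
  obtain ⟨ψ, hψ, hψv, -⟩ := exists_isometry_of_pairing_eq_one hs he₁ hf₁ (by rw [hφ, hvv]) h₁ hw
  obtain ⟨χ, hχ, hχv, hχe⟩ := exists_isometry_of_pairing_eq_one (e := f₁) (f := e₁)
    (v := ψ (φ v')) hs hf₁ he₁ (by rw [hψ, hφ, hvv']) (by rw [hs, h₁])
    (by rw [← hψv, hψ, hφ, hv])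
  exact ⟨(φ.trans ψ).trans χ, fun x y => by simp [hφ, hψ, hχ], by simp [hψv, hχe], by simp [hχv]⟩

end Transvections

theorem gramBilin_symm {n : ℕ} {G : Matrix (Fin n) (Fin n) ℤ} (hG : G.IsSymm)
    (x y : Fin n → ℤ) : gramBilin G x y = gramBilin G y x := by
  simp only [gramBilin, Matrix.toLinearMap₂'_apply']
  rw [Matrix.dotProduct_mulVec, ← Matrix.mulVec_transpose, hG.eq, dotProduct_comm]

theorem prodBilin_apply {M N : Type*} [AddCommGroup M] [AddCommGroup N] [Module ℤ M] [Module ℤ N]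
    (BM : M →ₗ[ℤ] M →ₗ[ℤ] ℤ) (BN : N →ₗ[ℤ] N →ₗ[ℤ] ℤ) (x y : M × N) :
    prodBilin BM BN x y = BM x.1 y.1 + BN x.2 y.2 := rfl

theorem gramBilin_UGram_apply (x y : Fin 2 → ℤ) :
    gramBilin UGram x y = x 0 * y 1 + x 1 * y 0 := by
  simp [gramBilin, UGram, Matrix.toLinearMap₂'_apply', Matrix.mulVec, dotProduct,
    Fin.sum_univ_two]

theorem gramBilin_E8Gram_even (x : Fin 8 → ℤ) : Even (gramBilin E8Gram x x) := by
  refine ⟨x 0 * x 2 + x 1 * x 3 + x 2 * x 3 + x 3 * x 4 + x 4 * x 5 + x 5 * x 6 + x 6 * x 7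
    - x 0 ^ 2 - x 1 ^ 2 - x 2 ^ 2 - x 3 ^ 2 - x 4 ^ 2 - x 5 ^ 2 - x 6 ^ 2 - x 7 ^ 2, ?_⟩
  simp [gramBilin, E8Gram, CartanMatrix.E₈, Matrix.toLinearMap₂'_apply', Matrix.mulVec,
    dotProduct, Fin.sum_univ_eight]
  ring

theorem E8Gram_isSymm : E8Gram.IsSymm := by
  unfold Matrix.IsSymm E8Gram
  decide

theorem LambdaB_symm (x y : LambdaM) : LambdaB x y = LambdaB y x := by
  have hU : UGram.IsSymm := by unfold Matrix.IsSymm UGram; decide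
  have h1 : (rankOneGram (-2)).IsSymm := by unfold Matrix.IsSymm rankOneGram; decide
  simp only [LambdaB, prodBilin_apply, gramBilin_symm hU x.1, gramBilin_symm hU x.2.1,
    gramBilin_symm hU x.2.2.1, gramBilin_symm E8Gram_isSymm x.2.2.2.1,
    gramBilin_symm E8Gram_isSymm x.2.2.2.2.1, gramBilin_symm h1 x.2.2.2.2.2]

theorem LambdaB_even (x : LambdaM) : Even (LambdaB x x) := by
  have hU : ∀ y, Even (gramBilin UGram y y) := fun y =>
    ⟨y 0 * y 1, by rw [gramBilin_UGram_apply]; ring⟩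
  have h1 : ∀ y, Even (gramBilin (rankOneGram (-2)) y y) := fun y =>
    ⟨-(y 0 * y 0), by
      simp [gramBilin, rankOneGram, Matrix.toLinearMap₂'_apply', Matrix.mulVec, dotProduct]
      ring⟩
  exact (hU _).add ((hU _).add ((hU _).add ((gramBilin_E8Gram_even _).add
    ((gramBilin_E8Gram_even _).add (h1 _)))))

theorem LambdaB_apply (x y : LambdaM) :
    LambdaB x y = x.1 0 * y.1 1 + x.1 1 * y.1 0 + TargetB14 x.2 y.2 := by
  rw [← gramBilin_UGram_apply]
  rfl

/-- The orthogonal complement of a hyperbolic plane in `Λ` is isometric to `U² ⊕ E8² ⊕ ⟨-2⟩`. -/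
theorem perpOf_isometricTo {K : Submodule ℤ LambdaM} {v v' : LambdaM}
    (hvv : LambdaB v v = 0) (hvv' : LambdaB v' v' = 0) (hv : LambdaB v v' = 1)
    (hK : ∀ x, x ∈ perpOf K ↔ LambdaB x v = 0 ∧ LambdaB x v' = 0) :
    IsometricTo (perpOf K) TargetB14 := by
  obtain ⟨φ, hφ, hφv, hφv'⟩ := exists_isometry_hyperbolic_pair (B := LambdaB)
    (e₁ := (![1, 0], 0)) (f₁ := (![0, 1], 0)) (e₂ := (0, ![1, 0], 0)) (f₂ := (0, ![0, 1], 0))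
    LambdaB_symm LambdaB_even
    (by simp [LambdaB_apply]) (by simp [LambdaB_apply]) (by simp [LambdaB_apply])
    (by simp [LambdaB_apply, TargetB14, prodBilin_apply, gramBilin_UGram_apply])
    (by simp [LambdaB_apply, TargetB14, prodBilin_apply, gramBilin_UGram_apply])
    (by simp [LambdaB_apply, TargetB14, prodBilin_apply, gramBilin_UGram_apply])
    (by simp [LambdaB_apply]) (by simp [LambdaB_apply]) (by simp [LambdaB_apply])
    (by simp [LambdaB_apply]) hvv hvv' hv
  have hmem : ∀ x, x ∈ perpOf K ↔ (φ x).1 = 0 := by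
    intro x
    rw [hK, ← hφ x v, ← hφ x v', hφv, hφv', LambdaB_apply, LambdaB_apply, funext_iff,
      Fin.forall_fin_two]
    simp [and_comm]
  have hsnd : ∀ x : perpOf K, φ x = (0, (φ x).2) := fun x =>
    Prod.ext ((hmem x).1 x.2) rfl
  refine ⟨LinearEquiv.ofBijective
    (LinearMap.snd ℤ _ _ ∘ₗ (φ : LambdaM →ₗ[ℤ] LambdaM) ∘ₗ (perpOf K).subtype) ⟨?_, ?_⟩, ?_⟩
  · intro x y hxy
    replace hxy : (φ x).2 = (φ y).2 := hxy
    apply Subtype.ext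
    apply φ.injective
    rw [hsnd x, hsnd y, hxy]
  · intro y
    exact ⟨⟨φ.symm (0, y), (hmem _).2 (by simp)⟩, by simp⟩
  · intro x y
    change TargetB14 (φ x).2 (φ y).2 = _
    rw [← hφ, LambdaB_apply, (hmem x).1 x.2]
    simp


/-- If `ι ∈ O(Λ)` is an involution of `Λ = U³ ⊕ E8² ⊕ ⟨−2⟩` whose invariant sublattice is
isometric to `U`, then `Λ` is the internal (orthogonal) direct sum of `Λ^ι` and `(Λ^ι)^⊥`,
and `(Λ^ι)^⊥` is isometric to `U² ⊕ E8² ⊕ ⟨−2⟩`. -/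
theorem orthogonal_splitting_invariant_U
    (ι : LambdaM ≃ₗ[ℤ] LambdaM) (hisom : IsIsometry ι) (hinvol : ∀ x, ι (ι x) = x)
    (hU : IsometricTo (invLattice ι) (gramBilin UGram)) :
    IsCompl (invLattice ι) (perpOf (invLattice ι)) ∧
    IsometricTo (perpOf (invLattice ι)) TargetB14 := by
  obtain ⟨e, he⟩ := hU
  set v := e.symm ![1, 0] with hv
  set v' := e.symm ![0, 1] with hv'
  have hvv : LambdaB v v = 0 := by simp [← he, hv, gramBilin_UGram_apply]
  have hvv' : LambdaB v' v' = 0 := by simp [← he, hv', gramBilin_UGram_apply]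
  have hvv₁ : LambdaB v v' = 1 := by simp [← he, hv, hv', gramBilin_UGram_apply]
  have hvv₂ : LambdaB v' v = 1 := by rw [LambdaB_symm, hvv₁]
  have hspan : ∀ s ∈ invLattice ι, ∃ a b : ℤ, s = a • (v : LambdaM) + b • (v' : LambdaM) := by
    intro s hs
    refine ⟨e ⟨s, hs⟩ 0, e ⟨s, hs⟩ 1, ?_⟩
    have h : (⟨s, hs⟩ : invLattice ι) = e ⟨s, hs⟩ 0 • v + e ⟨s, hs⟩ 1 • v' := by
      apply e.injective
      rw [map_add, map_smul, map_smul, hv, hv', e.apply_symm_apply, e.apply_symm_apply]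
      ext i
      fin_cases i <;> simp
    exact congrArg Subtype.val h
  have hK : ∀ x, x ∈ perpOf (invLattice ι) ↔ LambdaB x v = 0 ∧ LambdaB x v' = 0 := by
    intro x
    refine ⟨fun h => ⟨h _ v.2, h _ v'.2⟩, fun h s hs => ?_⟩
    obtain ⟨a, b, rfl⟩ := hspan s hs
    rw [map_add, map_smul, map_smul, h.1, h.2]
    simp
  refine ⟨⟨?_, ?_⟩, perpOf_isometricTo hvv hvv' hvv₁ hK⟩
  · rw [Submodule.disjoint_def]
    intro x hx hxp
    obtain ⟨a, b, rfl⟩ := hspan x hx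
    rw [hK] at hxp
    simp only [map_add, map_smul, LinearMap.add_apply, LinearMap.smul_apply, smul_eq_mul, hvv,
      hvv', hvv₁, hvv₂, mul_zero, mul_one, add_zero, zero_add] at hxp
    simp [hxp.1, hxp.2]
  · rw [codisjoint_iff, eq_top_iff]
    intro x _
    rw [Submodule.mem_sup]
    refine ⟨LambdaB x v' • (v : LambdaM) + LambdaB x v • (v' : LambdaM),
      add_mem (Submodule.smul_mem _ _ v.2) (Submodule.smul_mem _ _ v'.2),
      x - (LambdaB x v' • (v : LambdaM) + LambdaB x v • (v' : LambdaM)), ?_, by abel⟩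
    rw [hK]
    simp only [map_add, map_sub, map_smul, LinearMap.add_apply, LinearMap.sub_apply,
      LinearMap.smul_apply, smul_eq_mul, hvv, hvv', hvv₁, hvv₂, mul_zero, mul_one, add_zero,
      zero_add, sub_self, and_self]
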